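/- arXiv:2304.09006 — 5 statements merged into one kernel-verified Lean document; each statement's English description precedes it below -/
import Mathlib

section
/- Let d ≥ 1, let λ, Δ ∈ ℝ^d, and let X be a d×d doubly stochastic real matrix. Then Σ_{p,q} λ_p X_{pq} Δ_q ≥ Σ_i λ↓_i Δ↑_i, where λ↓ is the decreasing rearrangement of λ and Δ↑ is the increasing rearrangement of Δ. -/
/-- The entries of `v` sorted in increasing order. -/
noncomputable def sortAsc {d : ℕ} (v : Fin d → ℝ) : Fin d → ℝ :=
  v ∘ Tuple.sort v

/-- The entries of `v` sorted in decreasing order. -/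
noncomputable def sortDesc {d : ℕ} (v : Fin d → ℝ) : Fin d → ℝ :=
  fun i => (v ∘ Tuple.sort v) i.rev

theorem sortAsc_monotone {d : ℕ} (v : Fin d → ℝ) : Monotone (sortAsc v) :=
  Tuple.monotone_sort v

theorem sortDesc_antitone {d : ℕ} (v : Fin d → ℝ) : Antitone (sortDesc v) :=
  fun _ _ h => Tuple.monotone_sort v (Fin.rev_le_rev.mpr h)

/-- The rearrangement inequality: pairing the entries of two vectors in opposite orders minimizes
the sum of products over all pairings. -/
theorem sum_sortDesc_mul_sortAsc_le {d : ℕ} (u v : Fin d → ℝ) (σ : Equiv.Perm (Fin d)) :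
    ∑ i, sortDesc u i * sortAsc v i ≤ ∑ i, u i * v (σ i) := by
  have hle := ((sortDesc_antitone u).antivary (sortAsc_monotone v)).sum_mul_le_sum_mul_comp_perm
    (σ := (Fin.revPerm.trans (Tuple.sort u)).trans (σ.trans (Tuple.sort v).symm))
  refine hle.trans_eq ?_
  rw [← Equiv.sum_comp (Fin.revPerm.trans (Tuple.sort u)) fun i => u i * v (σ i)]
  simp [sortDesc, sortAsc]

/-- For `λ, Δ ∈ ℝ^d` and a doubly stochastic `d × d` matrix `X`,
`Σ_{p,q} λ_p X_{pq} Δ_q ≥ Σ_i λ↓_i Δ↑_i`. -/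
theorem stmt_1 (d : ℕ) (hd : 1 ≤ d) (lam Δ : Fin d → ℝ) (X : Matrix (Fin d) (Fin d) ℝ)
    (hX_nonneg : ∀ p q : Fin d, 0 ≤ X p q)
    (hX_rows : ∀ p : Fin d, ∑ q : Fin d, X p q = 1)
    (hX_cols : ∀ q : Fin d, ∑ p : Fin d, X p q = 1) :
    ∑ p : Fin d, ∑ q : Fin d, lam p * X p q * Δ q ≥ ∑ i : Fin d, sortDesc lam i * sortAsc Δ i := by
  obtain ⟨w, hw_nonneg, hw_sum, rfl⟩ := exists_eq_sum_perm_of_mem_doublyStochastic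
    (mem_doublyStochastic_iff_sum.mpr ⟨hX_nonneg, hX_rows, hX_cols⟩)
  have hexpand : ∑ p, ∑ q, lam p * (∑ σ, w σ • σ.permMatrix ℝ) p q * Δ q =
      ∑ σ, w σ * ∑ p, lam p * Δ (σ p) := by
    simp_rw [Matrix.sum_apply, Finset.mul_sum, Finset.sum_mul]
    rw [Finset.sum_comm (s := (Finset.univ : Finset (Equiv.Perm (Fin d))))]
    refine Finset.sum_congr rfl fun p _ => ?_
    rw [Finset.sum_comm]
    refine Finset.sum_congr rfl fun σ _ => ?_
    simp [Equiv.Perm.permMatrix, PEquiv.toMatrix_apply, mul_left_comm, mul_assoc]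
  rw [ge_iff_le, hexpand]
  calc ∑ i, sortDesc lam i * sortAsc Δ i
      = ∑ σ, w σ * ∑ i, sortDesc lam i * sortAsc Δ i := by rw [← Finset.sum_mul, hw_sum, one_mul]
    _ ≤ ∑ σ, w σ * ∑ p, lam p * Δ (σ p) :=
      Finset.sum_le_sum fun σ _ =>
        mul_le_mul_of_nonneg_left (sum_sortDesc_mul_sortAsc_le lam Δ σ) (hw_nonneg σ)
end

section
/- (Matrix form of Proposition 1.) Let d ≥ 1, let A be a d×d Hermitian complex matrix with eigenvalue vector μ ∈ ℝ^d (listed with multiplicity), let ρ be a d×d positive semidefinite Hermitian matrix with trace 1 and eigenvalue vector λ ∈ ℝ^d, and let W ∈ ℝ. Then the real part of Tr(U ρ U* A) is ≥ W for every d×d unitary matrix U if and only if Σ_i λ↓_i μ↑_i ≥ W, where λ↓ is the decreasing rearrangement of λ and μ↑ is the increasing rearrangement of μ. -/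
open scoped ComplexOrder

open Matrix

/-- The real part of `Tr(Q diag(l) Q* diag(a))` is the bilinear form of `a` and `l` with weights
`|Q i j|²`. -/
lemma re_trace_conj_diagonal_mul_diagonal {n : Type*} [Fintype n] [DecidableEq n]
    (Q : Matrix n n ℂ) (a l : n → ℝ) :
    (Matrix.trace (Q * diagonal (fun i => (l i : ℂ)) * star Q *
      diagonal (fun i => (a i : ℂ)))).re = a ⬝ᵥ (Q.map Complex.normSq) *ᵥ l := by
  simp only [Matrix.trace, diag_apply, mul_diagonal, Matrix.mul_apply (N := star Q), star_apply,
    dotProduct, mulVec, map_apply, Complex.re_sum, Complex.re_mul_ofReal]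
  refine Finset.sum_congr rfl fun i _ => ?_
  rw [mul_comm]
  congr 1
  refine Finset.sum_congr rfl fun j _ => ?_
  simp [Complex.normSq_apply]
  ring

/-- The entrywise squared modulus of a unitary matrix is doubly stochastic. -/
lemma map_normSq_mem_doublyStochastic {n : Type*} [Fintype n] [DecidableEq n]
    {Q : Matrix n n ℂ} (hQ : Q ∈ unitaryGroup n ℂ) :
    Q.map Complex.normSq ∈ doublyStochastic ℝ n := by
  rw [mem_doublyStochastic_iff_sum]
  refine ⟨fun i j => Complex.normSq_nonneg _, fun i => ?_, fun j => ?_⟩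
  · have h := congrFun (congrFun (mem_unitaryGroup_iff.1 hQ) i) i
    simp only [Matrix.mul_apply, star_apply, RCLike.star_def, Complex.mul_conj,
      one_apply_eq] at h
    exact_mod_cast h
  · have h := congrFun (congrFun (mem_unitaryGroup_iff'.1 hQ) j) j
    simp only [Matrix.mul_apply, star_apply, RCLike.star_def, ← Complex.normSq_eq_conj_mul_self,
      one_apply_eq] at h
    exact_mod_cast h

/-- A lower bound over permutations extends to all doubly stochastic matrices. -/
lemma le_dotProduct_mulVec_of_mem_doublyStochastic {n : Type*} [Fintype n] [DecidableEq n]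
    {D : Matrix n n ℝ} (hD : D ∈ doublyStochastic ℝ n) {a l : n → ℝ} {S : ℝ}
    (hS : ∀ σ : Equiv.Perm n, S ≤ ∑ i, a i * l (σ i)) : S ≤ a ⬝ᵥ D *ᵥ l := by
  obtain ⟨w, hw, hw1, rfl⟩ := exists_eq_sum_perm_of_mem_doublyStochastic hD
  calc S = ∑ σ, w σ * S := by rw [← Finset.sum_mul, hw1, one_mul]
    _ ≤ ∑ σ : Equiv.Perm n, w σ * ∑ i, a i * l (σ i) :=
      Finset.sum_le_sum fun σ _ => mul_le_mul_of_nonneg_left (hS σ) (hw σ)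
    _ = _ := by
      simp_rw [sum_mulVec, dotProduct_sum, smul_mulVec, permMatrix_mulVec, dotProduct_smul,
        smul_eq_mul, dotProduct, Function.comp_apply]

lemma permMatrix_mem_unitaryGroup {n : Type*} [Fintype n] [DecidableEq n] (σ : Equiv.Perm n) :
    σ.permMatrix ℂ ∈ unitaryGroup n ℂ := by
  rw [mem_unitaryGroup_iff, star_eq_conjTranspose, conjTranspose_permMatrix, ← permMatrix_mul]
  simp

lemma map_normSq_permMatrix {n : Type*} [DecidableEq n] (σ : Equiv.Perm n) :
    (σ.permMatrix ℂ).map Complex.normSq = σ.permMatrix ℝ := by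
  ext i j
  simp only [map_apply, Equiv.Perm.permMatrix, PEquiv.toMatrix_apply]
  split_ifs <;> simp

/-- The oppositely sorted pairing of two vectors is the smallest of their pairings. -/
lemma exists_perm_sum_sortDesc_mul_sortAsc {d : ℕ} (l a : Fin d → ℝ) (p q : Equiv.Perm (Fin d)) :
    (∃ σ : Equiv.Perm (Fin d),
      ∑ i, sortDesc (l ∘ p) i * sortAsc (a ∘ q) i = ∑ i, a i * l (σ i)) ∧
    ∀ σ : Equiv.Perm (Fin d),
      ∑ i, sortDesc (l ∘ p) i * sortAsc (a ∘ q) i ≤ ∑ i, a i * l (σ i) := by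
  let π : Equiv.Perm (Fin d) := (Fin.revPerm.trans (Tuple.sort (l ∘ p))).trans p
  let τ : Equiv.Perm (Fin d) := (Tuple.sort (a ∘ q)).trans q
  have hl : sortDesc (l ∘ p) = l ∘ π := rfl
  have ha : sortAsc (a ∘ q) = a ∘ τ := rfl
  have hanti : Antivary (sortDesc (l ∘ p)) (sortAsc (a ∘ q)) :=
    Antitone.antivary (fun i j hij => Tuple.monotone_sort (l ∘ p) (Fin.rev_le_rev.2 hij))
      (Tuple.monotone_sort (a ∘ q))
  constructor
  · refine ⟨τ.symm.trans π, ?_⟩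
    rw [← Equiv.sum_comp τ (fun i => a i * l (τ.symm.trans π i))]
    simp [hl, ha, mul_comm]
  · intro σ
    refine (hanti.sum_mul_le_sum_comp_perm_mul (σ := (τ.trans σ).trans π.symm)).trans_eq ?_
    rw [← Equiv.sum_comp τ (fun i => a i * l (σ i))]
    simp [hl, ha, mul_comm]

/-- In the eigenbases of `ρ` and `A`, `Re Tr(U ρ U* A)` is a bilinear form of the eigenvalues. -/
lemma re_trace_conj_mul_eq {n : Type*} [Fintype n] [DecidableEq n] {A ρ : Matrix n n ℂ}
    (hA : A.IsHermitian) (hρ : ρ.IsHermitian) (U : Matrix n n ℂ) :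
    (Matrix.trace (U * ρ * star U * A)).re = hA.eigenvalues ⬝ᵥ
      ((star (hA.eigenvectorUnitary : Matrix n n ℂ) * U *
        (hρ.eigenvectorUnitary : Matrix n n ℂ)).map Complex.normSq) *ᵥ hρ.eigenvalues := by
  rw [← re_trace_conj_diagonal_mul_diagonal]
  conv_lhs => rw [hA.spectral_theorem, hρ.spectral_theorem]
  simp only [Unitary.conjStarAlgAut_apply, star_mul, star_star, ← mul_assoc]
  rw [trace_mul_comm]
  simp only [mul_assoc]
  rfl

/-- matrix form of Proposition 1: for a Hermitian `A` with eigenvalue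
vector `μ` and a density matrix `ρ` with eigenvalue vector `λ`,
`Re Tr(U ρ U* A) ≥ W` for every unitary `U` iff `Σ_i λ↓_i μ↑_i ≥ W`. -/
theorem stmt_3 (d : ℕ) (hd : 1 ≤ d) (A ρ : Matrix (Fin d) (Fin d) ℂ)
    (hA : A.IsHermitian) (hρ : ρ.PosSemidef) (hρtr : ρ.trace = 1)
    (μ lam : Fin d → ℝ)
    (hμ : ∃ σ : Equiv.Perm (Fin d), μ = hA.eigenvalues ∘ σ)
    (hlam : ∃ σ : Equiv.Perm (Fin d), lam = hρ.1.eigenvalues ∘ σ)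
    (W : ℝ) :
    (∀ U : Matrix (Fin d) (Fin d) ℂ, U ∈ Matrix.unitaryGroup (Fin d) ℂ →
        (Matrix.trace (U * ρ * star U * A)).re ≥ W) ↔
      ∑ i : Fin d, sortDesc lam i * sortAsc μ i ≥ W := by
  obtain ⟨q, rfl⟩ := hμ
  obtain ⟨p, rfl⟩ := hlam
  obtain ⟨⟨σ, hσ⟩, hmin⟩ :=
    exists_perm_sum_sortDesc_mul_sortAsc hρ.1.eigenvalues hA.eigenvalues p q
  have hV := hA.eigenvectorUnitary.2
  have hR := hρ.1.eigenvectorUnitary.2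
  constructor
  · intro h
    have hU := h _ (mul_mem (mul_mem hV (permMatrix_mem_unitaryGroup σ)) (Unitary.star_mem hR))
    rw [re_trace_conj_mul_eq hA hρ.1, mul_assoc, mul_assoc, mul_assoc,
      mem_unitaryGroup_iff'.1 hR, mul_one, ← mul_assoc, mem_unitaryGroup_iff'.1 hV, one_mul,
      map_normSq_permMatrix, permMatrix_mulVec] at hU
    rwa [hσ]
  · intro h U hU
    rw [re_trace_conj_mul_eq hA hρ.1]
    exact h.trans (le_dotProduct_mulVec_of_mem_doublyStochastic
      (map_normSq_mem_doublyStochastic (mul_mem (mul_mem (Unitary.star_mem hV) hU) hR)) hmin)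
end

section
/- (The inner ball is contained in the AWB polytope.) Let d ≥ 2, W ≤ 1/d, and Δ ∈ ℝ^d with Σ_i Δ_i = 1 and Σ_i Δ_i² = d. If λ ∈ ℝ^d satisfies Σ_i λ_i = 1 and ‖λ − u‖ ≤ (1 − dW)/√(d(d² − 1)), where u = (1/d,…,1/d), then for every permutation π of {0,…,d−1} one has Σ_i λ_i Δ_{π(i)} ≥ W. -/
/-- Centering two vectors of unit sum at the uniform vector lowers their dot product by `1 / d`. -/
theorem sum_sub_inv_card_mul_sub_inv_card {d : ℕ} (hd : (d : ℝ) ≠ 0) {x y : Fin d → ℝ}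
    (hx : ∑ i, x i = 1) (hy : ∑ i, y i = 1) :
    ∑ i, (x i - 1 / (d : ℝ)) * (y i - 1 / (d : ℝ)) = ∑ i, x i * y i - 1 / (d : ℝ) := by
  simp only [sub_mul, mul_sub, Finset.sum_sub_distrib, ← Finset.sum_mul, ← Finset.mul_sum, hx, hy,
    Finset.sum_const, Finset.card_univ, Fintype.card_fin, nsmul_eq_mul]
  field_simp
  ring

/-- the inner ball is contained in the AWB polytope: if
`Σ_i λ_i = 1` and `‖λ − u‖ ≤ (1 − dW)/√(d(d² − 1))`, then
`Σ_i λ_i Δ_{π(i)} ≥ W` for every permutation `π`. -/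
theorem stmt_10 (d : ℕ) (hd : 2 ≤ d) (W : ℝ) (hW : W ≤ 1 / (d : ℝ)) (Δ : Fin d → ℝ)
    (hΔ1 : ∑ i : Fin d, Δ i = 1) (hΔ2 : ∑ i : Fin d, (Δ i) ^ 2 = (d : ℝ))
    (lam : Fin d → ℝ) (hsum : ∑ i : Fin d, lam i = 1)
    (hball : Real.sqrt (∑ i : Fin d, (lam i - 1 / (d : ℝ)) ^ 2) ≤
      (1 - (d : ℝ) * W) / Real.sqrt ((d : ℝ) * ((d : ℝ) ^ 2 - 1))) :
    ∀ π : Equiv.Perm (Fin d), ∑ i : Fin d, lam i * Δ (π i) ≥ W := by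
  intro π
  have hd2 : (2 : ℝ) ≤ d := by exact_mod_cast hd
  have hd0 : (d : ℝ) ≠ 0 := by positivity
  have hD : 0 < (d : ℝ) * ((d : ℝ) ^ 2 - 1) := mul_pos (by linarith) (by nlinarith)
  have hπ1 : ∑ i : Fin d, Δ (π i) = 1 := (Equiv.sum_comp π Δ).trans hΔ1
  have hπ2 : ∑ i : Fin d, (Δ (π i)) ^ 2 = (d : ℝ) :=
    (Equiv.sum_comp π fun i => (Δ i) ^ 2).trans hΔ2
  have hcov := sum_sub_inv_card_mul_sub_inv_card hd0 hsum hπ1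
  have hvar : ∑ i : Fin d, (Δ (π i) - 1 / (d : ℝ)) ^ 2 = d - 1 / (d : ℝ) := by
    simpa only [← pow_two, hπ2] using sum_sub_inv_card_mul_sub_inv_card hd0 hπ1 hπ1
  have hcs := Finset.sum_mul_sq_le_sq_mul_sq Finset.univ
    (fun i => lam i - 1 / (d : ℝ)) (fun i => Δ (π i) - 1 / (d : ℝ))
  simp only [hcov, hvar] at hcs
  have hrad : ∑ i : Fin d, (lam i - 1 / (d : ℝ)) ^ 2 ≤
      (1 - (d : ℝ) * W) ^ 2 / ((d : ℝ) * ((d : ℝ) ^ 2 - 1)) := by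
    simpa only [div_pow, Real.sq_sqrt hD.le] using (Real.sqrt_le_iff.mp hball).2
  have hvar_nonneg : 0 ≤ (d : ℝ) - 1 / (d : ℝ) :=
    hvar ▸ Finset.sum_nonneg fun i _ => sq_nonneg _
  have hprod : (1 - (d : ℝ) * W) ^ 2 / ((d : ℝ) * ((d : ℝ) ^ 2 - 1)) * (d - 1 / (d : ℝ)) =
      (1 / (d : ℝ) - W) ^ 2 := by
    have hne : (d : ℝ) ^ 2 - 1 ≠ 0 := (by nlinarith : (0 : ℝ) < (d : ℝ) ^ 2 - 1).ne'
    field_simp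
  have hsq := hcs.trans ((mul_le_mul_of_nonneg_right hrad hvar_nonneg).trans_eq hprod)
  linarith [(abs_le_of_sq_le_sq' hsq (sub_nonneg.mpr hW)).1]
end

section
/- (Qubit AWP characterization.) Let Δ₀ = (1 − √3)/2 and Δ₁ = (1 + √3)/2, and let λ ∈ ℝ with 1/2 ≤ λ ≤ 1. Then the following are equivalent: (i) λΔ₀ + (1 − λ)Δ₁ ≥ 0; (ii) λ ≤ 1/2 + 1/(2√3); (iii) the purity λ² + (1 − λ)² ≤ 2/3. -/
/-- qubit AWP characterization: with `Δ₀ = (1 − √3)/2`,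
`Δ₁ = (1 + √3)/2` and `1/2 ≤ λ ≤ 1`, the conditions
(i) `λΔ₀ + (1 − λ)Δ₁ ≥ 0`, (ii) `λ ≤ 1/2 + 1/(2√3)`, and
(iii) `λ² + (1 − λ)² ≤ 2/3` are equivalent. -/
theorem stmt_11 (lam : ℝ) (h1 : 1 / 2 ≤ lam) (h2 : lam ≤ 1) :
    (lam * ((1 - Real.sqrt 3) / 2) + (1 - lam) * ((1 + Real.sqrt 3) / 2) ≥ 0 ↔
      lam ≤ 1 / 2 + 1 / (2 * Real.sqrt 3)) ∧
    (lam ≤ 1 / 2 + 1 / (2 * Real.sqrt 3) ↔ lam ^ 2 + (1 - lam) ^ 2 ≤ 2 / 3) := by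
  have hs : 0 < Real.sqrt 3 := by positivity
  have hsq : Real.sqrt 3 * Real.sqrt 3 = 3 := Real.mul_self_sqrt (by norm_num)
  have hinv : 1 / (2 * Real.sqrt 3) = Real.sqrt 3 / 6 := by
    rw [div_eq_div_iff (by positivity) (by norm_num)]
    linarith
  rw [hinv]
  refine ⟨⟨fun h => ?_, fun h => ?_⟩, ⟨fun h => ?_, fun h => ?_⟩⟩
  · refine le_of_mul_le_mul_right ?_ hs
    linarith
  · have := mul_le_mul_of_nonneg_right h hs.le
    linarith
  · have := mul_self_le_mul_self (by linarith : 0 ≤ lam - 1 / 2)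
      (by linarith : lam - 1 / 2 ≤ Real.sqrt 3 / 6)
    linarith
  · have := le_of_abs_le <| abs_le_of_sq_le_sq (a := lam - 1 / 2) (b := Real.sqrt 3 / 6)
      (by linarith) (by positivity)
    linarith
end

section
/- (Transposition constraints force equal eigenvalues.) Let d ≥ 2, let λ ∈ ℝ^d be decreasing (λ_0 ≥ λ_1 ≥ … ≥ λ_{d−1}) and Δ ∈ ℝ^d, and let 0 ≤ p < q ≤ d − 1 with Δ_p ≠ Δ_q. If Σ_i λ_i Δ_{τ(i)} = Σ_i λ_i Δ_i, where τ is the transposition exchanging p and q, then λ_k = λ_p for every k with p ≤ k ≤ q. -/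
/-- Swapping two entries changes a pairing by the product of the two differences. -/
theorem sum_mul_swap_sub_sum_mul {ι R : Type*} [Fintype ι] [DecidableEq ι] [CommRing R]
    (f g : ι → R) {p q : ι} (hpq : p ≠ q) :
    ∑ i, f i * g (Equiv.swap p q i) - ∑ i, f i * g i = (f p - f q) * (g q - g p) := by
  rw [← Finset.sum_sub_distrib, Fintype.sum_eq_add p q hpq]
  · rw [Equiv.swap_apply_left, Equiv.swap_apply_right]
    ring
  · rintro i ⟨hip, hiq⟩
    rw [Equiv.swap_apply_of_ne_of_ne hip hiq, sub_self]

/-- transposition constraints force equal eigenvalues: for a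
decreasing `λ`, indices `p < q` with `Δ_p ≠ Δ_q`, if the pairing after swapping
`p` and `q` equals the identity pairing, then `λ_k = λ_p` for all `p ≤ k ≤ q`. -/
theorem stmt_14 (d : ℕ) (hd : 2 ≤ d) (lam Δ : Fin d → ℝ) (hlam : Antitone lam)
    (p q : Fin d) (hpq : p < q) (hΔ : Δ p ≠ Δ q)
    (heq : ∑ i : Fin d, lam i * Δ (Equiv.swap p q i) = ∑ i : Fin d, lam i * Δ i) :
    ∀ k : Fin d, p ≤ k → k ≤ q → lam k = lam p := by
  intro k hpk hkq
  have hprod : (lam p - lam q) * (Δ q - Δ p) = 0 := by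
    rw [← sum_mul_swap_sub_sum_mul lam Δ hpq.ne, heq, sub_self]
  have hends : lam p = lam q :=
    sub_eq_zero.mp ((mul_eq_zero.mp hprod).resolve_right (sub_ne_zero.mpr hΔ.symm))
  exact le_antisymm (hlam hpk) (hends.trans_le (hlam hkq))
end
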